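/- arXiv:1102.3191 — 2 statements merged into one kernel-verified Lean document; each statement's English description precedes it below -/
import Mathlib

section
/- Let k be a field and p, q, m natural numbers. In the polynomial ring R = k[x_p,…,x_{m+p+q}, y_0,…,y_{m+p}] (so with m+q+1 variables x_p,…,x_{m+p+q} and m+p+1 variables y_0,…,y_{m+p}), the ideal I generated by the binomials x_i·y_j − x_j·y_i for all p ≤ i, j ≤ m+p is a prime ideal; equivalently, the quotient ring R/I is an integral domain. -/
open MvPolynomial

/-- A monomial map whose fibres are congruent modulo `I` has kernel `I`, so `I` is prime. -/
theorem toric_isPrime {k σ τ : Type*} [Field k] (I : Ideal (MvPolynomial σ k))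
    (w : σ → (τ →₀ ℕ))
    (hle : ∀ f ∈ I, aeval (fun v => monomial (w v) (1 : k)) f = 0)
    (hc : ∀ a b : σ →₀ ℕ, Finsupp.linearCombination ℕ w a = Finsupp.linearCombination ℕ w b →
      monomial a (1 : k) - monomial b 1 ∈ I) : I.IsPrime := by
  classical
  let φ : MvPolynomial σ k →ₐ[k] MvPolynomial τ k := aeval (fun v => monomial (w v) (1 : k))
  have hφ : ∀ (a : σ →₀ ℕ), φ (monomial a 1) = monomial (Finsupp.linearCombination ℕ w a) 1 := by
    intro a
    simp only [φ, aeval_monomial, map_one, one_mul, Finsupp.linearCombination_apply,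
      monomial_pow, one_pow, Finsupp.prod, Finsupp.sum]
    exact (monomial_sum_one _ _).symm
  let g : (τ →₀ ℕ) → MvPolynomial σ k ⧸ I := fun t =>
    if h : ∃ a : σ →₀ ℕ, Finsupp.linearCombination ℕ w a = t then
      Ideal.Quotient.mk I (monomial h.choose 1) else 0
  let ψ : MvPolynomial τ k →ₗ[k] MvPolynomial σ k ⧸ I := (basisMonomials τ k).constr k g
  have hψ : ψ ∘ₗ φ.toLinearMap = (Ideal.Quotient.mkₐ k I).toLinearMap := by
    apply (basisMonomials σ k).ext
    intro a
    have h : ∃ a' : σ →₀ ℕ, Finsupp.linearCombination ℕ w a' =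
      Finsupp.linearCombination ℕ w a := ⟨a, rfl⟩
    have h1 : ψ (monomial (Finsupp.linearCombination ℕ w a) 1) =
        g (Finsupp.linearCombination ℕ w a) := by
      have := (basisMonomials τ k).constr_basis k g (Finsupp.linearCombination ℕ w a)
      simpa [ψ] using this
    simp only [coe_basisMonomials, LinearMap.comp_apply, AlgHom.toLinearMap_apply, hφ, h1]
    simp only [g, dif_pos h]
    exact Ideal.Quotient.eq.2 (hc _ _ h.choose_spec)
  have hker : I = RingHom.ker φ := by
    apply le_antisymm
    · intro f hf
      exact hle f hf
    · intro f hf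
      have h0 : φ f = 0 := hf
      have := LinearMap.congr_fun hψ f
      simp only [LinearMap.comp_apply, AlgHom.toLinearMap_apply, h0, map_zero] at this
      exact Ideal.Quotient.eq_zero_iff_mem.1 this.symm
  rw [hker]
  exact RingHom.ker_isPrime φ

theorem exists_of_linComb_pos {σ τ : Type*} (w : σ → (τ →₀ ℕ)) (b : σ →₀ ℕ) (t : τ)
    (h : 0 < Finsupp.linearCombination ℕ w b t) : ∃ u, 0 < b u ∧ 0 < w u t := by
  rw [Finsupp.linearCombination_apply, Finsupp.sum, Finsupp.finsetSum_apply] at h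
  obtain ⟨u, -, hu⟩ := Finset.exists_ne_zero_of_sum_ne_zero h.ne'
  simp only [Finsupp.smul_apply, smul_eq_mul] at hu
  exact ⟨u, Nat.pos_of_ne_zero (left_ne_zero_of_mul hu),
    Nat.pos_of_ne_zero (right_ne_zero_of_mul hu)⟩

theorem linComb_pos {σ τ : Type*} (w : σ → (τ →₀ ℕ)) (a : σ →₀ ℕ) (v : σ) (t : τ)
    (ha : 0 < a v) (hw : 0 < w v t) : 0 < Finsupp.linearCombination ℕ w a t := by
  rw [Finsupp.linearCombination_apply, Finsupp.sum, Finsupp.finsetSum_apply]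
  have : 0 < (a v • w v) t := by simp [ha, hw]
  exact this.trans_le (Finset.single_le_sum (f := fun u => (a u • w u) t)
    (fun _ _ => Nat.zero_le _) (by simp [ha.ne']))

theorem exists_eq_add_single {σ : Type*} (b : σ →₀ ℕ) (u : σ) (h : 0 < b u) :
    ∃ c, b = c + Finsupp.single u 1 :=
  ⟨b - Finsupp.single u 1, (tsub_add_cancel_of_le (by
    rw [Finsupp.single_le_iff]; exact h)).symm⟩

/-- Exchange moves connect the fibres. -/
theorem fibre_of_step {k σ τ : Type*} [Field k] (I : Ideal (MvPolynomial σ k))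
    (w : σ → (τ →₀ ℕ)) (hw0 : ∀ v, w v ≠ 0)
    (hstep : ∀ (b : σ →₀ ℕ) (v : σ),
      (∀ t, 0 < w v t → 0 < Finsupp.linearCombination ℕ w b t) →
      ∃ c : σ →₀ ℕ, Finsupp.linearCombination ℕ w (c + Finsupp.single v 1) =
        Finsupp.linearCombination ℕ w b ∧
        monomial (c + Finsupp.single v 1) (1 : k) - monomial b 1 ∈ I) :
    ∀ a b : σ →₀ ℕ, Finsupp.linearCombination ℕ w a = Finsupp.linearCombination ℕ w b →
      monomial a (1 : k) - monomial b 1 ∈ I := by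
  intro a
  induction hn : a.degree generalizing a with
  | zero =>
    intro b hab
    have ha : a = 0 := (Finsupp.degree_eq_zero_iff a).1 hn
    subst ha
    have hb : b = 0 := by
      by_contra hb
      obtain ⟨u, hu⟩ := Finsupp.ne_iff.1 hb
      obtain ⟨t, ht⟩ := Finsupp.ne_iff.1 (hw0 u)
      have := linComb_pos w b u t (Nat.pos_of_ne_zero hu) (Nat.pos_of_ne_zero ht)
      rw [← hab] at this
      simp at this
    subst hb
    simp
  | succ n ih =>
    intro b hab
    have ha : a ≠ 0 := by
      rintro rfl
      simp at hn
    obtain ⟨v, hv⟩ := Finsupp.ne_iff.1 ha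
    have hv' : 0 < a v := Nat.pos_of_ne_zero hv
    obtain ⟨c, hc1, hc2⟩ := hstep b v (fun t ht => hab ▸ linComb_pos w a v t hv' ht)
    obtain ⟨a', rfl⟩ := exists_eq_add_single a v hv'
    have h1 := ih a' (by simpa using hn) c (by
      have := hab.trans hc1.symm
      simpa using this)
    have h2 : monomial (a' + Finsupp.single v 1) (1 : k) - monomial (c + Finsupp.single v 1) 1
        ∈ I := by
      have := I.mul_mem_right (monomial (Finsupp.single v 1) (1 : k)) h1
      simpa [sub_mul, monomial_mul] using this
    simpa using I.add_mem h2 hc2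

theorem det_aux {k σ ι : Type*} [Field k] (x y : ι → σ)
    (w : σ → ((ι ⊕ (σ ⊕ Bool)) →₀ ℕ))
    (hx : ∀ i, w (x i) = Finsupp.single (Sum.inl i) 1 + Finsupp.single (Sum.inr (Sum.inr true)) 1)
    (hy : ∀ i, w (y i) = Finsupp.single (Sum.inl i) 1 + Finsupp.single (Sum.inr (Sum.inr false)) 1)
    (hf : ∀ v, (∃ i, v = x i) ∨ (∃ i, v = y i) ∨ w v = Finsupp.single (Sum.inr (Sum.inl v)) 1) :
    (Ideal.span {f : MvPolynomial σ k | ∃ i j : ι,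
      f = X (x i) * X (y j) - X (x j) * X (y i)}).IsPrime := by
  classical
  set I := (Ideal.span {f : MvPolynomial σ k | ∃ i j : ι,
      f = X (x i) * X (y j) - X (x j) * X (y i)}) with hI
  have hxy : ∀ i j, x i ≠ y j := by
    intro i j h
    have := DFunLike.congr_fun ((hx i).symm.trans ((congrArg w h).trans (hy j)))
      (Sum.inr (Sum.inr true))
    simp at this
  -- the exchange move
  have hmove : ∀ (c : σ →₀ ℕ) (i j : ι),
      Finsupp.linearCombination ℕ w (c + Finsupp.single (y j) 1 + Finsupp.single (x i) 1) =
      Finsupp.linearCombination ℕ w (c + Finsupp.single (y i) 1 + Finsupp.single (x j) 1) ∧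
      monomial (c + Finsupp.single (y j) 1 + Finsupp.single (x i) 1) (1 : k) -
      monomial (c + Finsupp.single (y i) 1 + Finsupp.single (x j) 1) 1 ∈ I := by
    intro c i j
    constructor
    · simp only [map_add, Finsupp.linearCombination_single, one_smul, hx, hy]
      abel
    · have h : X (x i) * X (y j) - X (x j) * X (y i) ∈ I := Ideal.subset_span ⟨i, j, rfl⟩
      have := I.mul_mem_left (monomial c (1 : k)) h
      convert this using 1
      simp only [X, mul_sub, monomial_mul, mul_one]
      congr 2 <;> congr 1 <;> abel
  apply toric_isPrime I w
  · have : I ≤ RingHom.ker (aeval (R := k) (fun v => monomial (w v) (1 : k))) := by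
      rw [hI, Ideal.span_le]
      rintro f ⟨i, j, rfl⟩
      simp only [SetLike.mem_coe, RingHom.mem_ker, map_sub, map_mul, aeval_X, monomial_mul,
        hx, hy, sub_eq_zero]
      congr 1
      abel
    exact this
  apply fibre_of_step I w
  · intro v h
    rcases hf v with ⟨i, rfl⟩ | ⟨i, rfl⟩ | hv
    · have := DFunLike.congr_fun ((hx i).symm.trans h) (Sum.inl i)
      simp at this
    · have := DFunLike.congr_fun ((hy i).symm.trans h) (Sum.inl i)
      simp at this
    · rw [hv] at h
      simp at h
  -- inversion lemmas
  have inv1 : ∀ u i, 0 < w u (Sum.inl i) → u = x i ∨ u = y i := by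
    intro u i h
    rcases hf u with ⟨j, rfl⟩ | ⟨j, rfl⟩ | hv
    · have hji : j = i := by
        by_contra hne
        simp [hx, Finsupp.single_apply, hne] at h
      simp [hji]
    · have hji : j = i := by
        by_contra hne
        simp [hy, Finsupp.single_apply, hne] at h
      simp [hji]
    · simp [hv] at h
  have inv2 : ∀ u, 0 < w u (Sum.inr (Sum.inr true)) → ∃ j, u = x j := by
    intro u h
    rcases hf u with ⟨j, rfl⟩ | ⟨j, rfl⟩ | hv
    · exact ⟨j, rfl⟩
    · simp [hy] at h
    · simp [hv] at h
  have inv3 : ∀ u, 0 < w u (Sum.inr (Sum.inr false)) → ∃ j, u = y j := by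
    intro u h
    rcases hf u with ⟨j, rfl⟩ | ⟨j, rfl⟩ | hv
    · simp [hx] at h
    · exact ⟨j, rfl⟩
    · simp [hv] at h
  have inv4 : ∀ u v, 0 < w u (Sum.inr (Sum.inl v)) → u = v := by
    intro u v h
    rcases hf u with ⟨j, rfl⟩ | ⟨j, rfl⟩ | hv
    · simp [hx] at h
    · simp [hy] at h
    · by_contra hne
      simp [hv, Finsupp.single_apply, hne] at h
  intro b v hb
  have easy : 0 < b v → ∃ c : σ →₀ ℕ, Finsupp.linearCombination ℕ w (c + Finsupp.single v 1) =
        Finsupp.linearCombination ℕ w b ∧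
        monomial (c + Finsupp.single v 1) (1 : k) - monomial b 1 ∈ I := by
    intro h
    obtain ⟨c, rfl⟩ := exists_eq_add_single b v h
    exact ⟨c, rfl, by simp⟩
  have two : ∀ i j, 0 < b (y i) → 0 < b (x j) →
      ∃ c, b = c + Finsupp.single (y i) 1 + Finsupp.single (x j) 1 := by
    intro i j h1 h2
    obtain ⟨c, rfl⟩ := exists_eq_add_single b (x j) h2
    have h3 : 0 < c (y i) := by
      simpa [Finsupp.single_apply, hxy j i] using h1
    obtain ⟨c', rfl⟩ := exists_eq_add_single c (y i) h3
    exact ⟨c', rfl⟩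
  rcases hf v with ⟨i, rfl⟩ | ⟨i, rfl⟩ | hv
  · obtain ⟨u, hu, hu'⟩ := exists_of_linComb_pos w b (Sum.inl i) (hb _ (by simp [hx]))
    rcases inv1 u i hu' with rfl | rfl
    · exact easy hu
    obtain ⟨u, hu2, hu2'⟩ := exists_of_linComb_pos w b (Sum.inr (Sum.inr true))
      (hb _ (by simp [hx]))
    obtain ⟨j, rfl⟩ := inv2 u hu2'
    obtain ⟨c, rfl⟩ := two i j hu hu2
    exact ⟨c + Finsupp.single (y j) 1, hmove c i j⟩
  · obtain ⟨u, hu, hu'⟩ := exists_of_linComb_pos w b (Sum.inl i) (hb _ (by simp [hy]))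
    rcases inv1 u i hu' with rfl | rfl
    swap
    · exact easy hu
    obtain ⟨u, hu2, hu2'⟩ := exists_of_linComb_pos w b (Sum.inr (Sum.inr false))
      (hb _ (by simp [hy]))
    obtain ⟨j, rfl⟩ := inv3 u hu2'
    obtain ⟨c, rfl⟩ := two j i hu2 hu
    refine ⟨c + Finsupp.single (x j) 1, ?_⟩
    rw [add_right_comm]
    exact hmove c j i
  · obtain ⟨u, hu, hu'⟩ := exists_of_linComb_pos w b (Sum.inr (Sum.inl v)) (hb _ (by simp [hv]))
    obtain rfl := inv4 u v hu'
    exact easy hu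

/-- In `R = k[x_p,…,x_{m+p+q}, y_0,…,y_{m+p}]` (the x-variable `x_{p+a}` being indexed by
`a : Fin (m+q+1)` and the y-variable `y_b` by `b : Fin (m+p+1)`), the ideal generated by
the binomials `x_i y_j - x_j y_i` for `p ≤ i, j ≤ m + p` is prime. -/
theorem determinantal_ideal_isPrime (k : Type*) [Field k] (p q m : ℕ)
    (I : Ideal (MvPolynomial (Fin (m + q + 1) ⊕ Fin (m + p + 1)) k))
    (hI : I = Ideal.span {f | ∃ i j : Fin (m + 1),
      f = X (Sum.inl ⟨(i : ℕ), by have := i.isLt; omega⟩)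
            * X (Sum.inr ⟨p + (j : ℕ), by have := j.isLt; omega⟩)
          - X (Sum.inl ⟨(j : ℕ), by have := j.isLt; omega⟩)
            * X (Sum.inr ⟨p + (i : ℕ), by have := i.isLt; omega⟩)}) :
    I.IsPrime := by
  subst hI
  let w : (Fin (m + q + 1) ⊕ Fin (m + p + 1)) →
      ((Fin (m + 1) ⊕ ((Fin (m + q + 1) ⊕ Fin (m + p + 1)) ⊕ Bool)) →₀ ℕ) := fun v =>
    match v with
    | Sum.inl a => if h : (a : ℕ) < m + 1 then
        Finsupp.single (Sum.inl ⟨a, h⟩) 1 + Finsupp.single (Sum.inr (Sum.inr true)) 1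
        else Finsupp.single (Sum.inr (Sum.inl (Sum.inl a))) 1
    | Sum.inr b => if h : p ≤ (b : ℕ) then
        Finsupp.single (Sum.inl ⟨b - p, by have := b.isLt; omega⟩) 1 +
          Finsupp.single (Sum.inr (Sum.inr false)) 1
        else Finsupp.single (Sum.inr (Sum.inl (Sum.inr b))) 1
  refine det_aux (k := k)
    (fun i : Fin (m + 1) => (Sum.inl ⟨(i : ℕ), by have := i.isLt; omega⟩ :
      Fin (m + q + 1) ⊕ Fin (m + p + 1)))
    (fun i : Fin (m + 1) => Sum.inr ⟨p + (i : ℕ), by have := i.isLt; omega⟩) w ?_ ?_ ?_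
  · intro i
    simp only [w, dif_pos i.isLt]
  · intro i
    simp [w]
  · rintro (a | b)
    · by_cases h : (a : ℕ) < m + 1
      · exact Or.inl ⟨⟨a, h⟩, rfl⟩
      · exact Or.inr (Or.inr (by simp only [w, dif_neg h]))
    · by_cases h : p ≤ (b : ℕ)
      · refine Or.inr (Or.inl ⟨⟨b - p, by have := b.isLt; omega⟩, ?_⟩)
        congr 1
        ext
        simp only
        omega
      · exact Or.inr (Or.inr (by simp only [w, dif_neg h]))
end

section
/- Let k be a field and p, q, m natural numbers. In the polynomial ring R = k[x_p,…,x_{m+p+q}, y_0,…,y_{m+p}] (so with m+q+1 variables x_p,…,x_{m+p+q} and m+p+1 variables y_0,…,y_{m+p}), let I be the ideal generated by the binomials x_i·y_j − x_j·y_i for all p ≤ i, j ≤ m+p. Then the Krull dimension of the quotient ring R/I equals m + p + q + 2. -/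
open MvPolynomial

theorem dim_le_of_integral {A B : Type*} [CommRing A] [CommRing B] (f : A →+* B)
    (hf : f.IsIntegral) : ringKrullDim B ≤ ringKrullDim A := by
  let := f.toAlgebra
  have : Algebra.IsIntegral A B := ⟨hf⟩
  refine Order.krullDim_le_of_strictMono (fun P => PrimeSpectrum.comap f P) ?_
  intro P Q h
  rw [← PrimeSpectrum.asIdeal_lt_asIdeal] at h ⊢
  exact Ideal.IsIntegral.comap_lt_comap h

theorem trdeg_aux {k B σ τ : Type*} [Field k] [CommRing B] [IsDomain B] [Algebra k B]
    [Fintype τ] (f : MvPolynomial σ k →ₐ[k] B) (hf : Function.Surjective f) (w : τ → B)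
    (h : ∀ a, ∃ c d, c ∈ Algebra.adjoin k (Set.range w) ∧ c ≠ 0 ∧
      d ∈ Algebra.adjoin k (Set.range w) ∧ c * f (X a) = d) (s : ℕ)
    (g : MvPolynomial (Fin s) k →ₐ[k] B) (hg : Function.Injective g) : s ≤ Fintype.card τ := by
  have hX : ∀ a, IsAlgebraic (Algebra.adjoin k (Set.range w)) (f (X a)) := by
    intro a
    obtain ⟨c, d, hc, hc0, hd, e⟩ := h a
    refine ⟨Polynomial.C ⟨c, hc⟩ * Polynomial.X - Polynomial.C ⟨d, hd⟩, ?_, ?_⟩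
    · intro h0
      have := congrArg (fun p => p.coeff 1) h0
      simp [Polynomial.coeff_C] at this
      exact hc0 (congrArg Subtype.val this)
    · simp [e]
  have : Algebra.IsAlgebraic (Algebra.adjoin k (Set.range w)) B := by
    refine ⟨fun b => ?_⟩
    obtain ⟨r, rfl⟩ := hf b
    induction r using MvPolynomial.induction_on with
    | C a =>
      rw [← MvPolynomial.algebraMap_eq, AlgHom.commutes,
        IsScalarTower.algebraMap_apply k (Algebra.adjoin k (Set.range w)) B]
      exact isAlgebraic_algebraMap _
    | add p q hp hq => rw [map_add]; exact hp.add hq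
    | mul_X p a hp => rw [map_mul]; exact hp.mul (hX a)
  have h1 := Algebra.IsAlgebraic.trdeg_le_cardinalMk k (Set.range w)
  have h2 := lift_trdeg_le_of_injective g hg
  rw [MvPolynomial.trdeg_of_isDomain] at h2
  have h3 : Cardinal.mk (Set.range w) ≤ (Fintype.card τ : ℕ) := by
    have := Cardinal.mk_range_le_lift (f := w)
    simp at this ⊢
    exact_mod_cast this
  have h4 := h1.trans h3
  have h5 := h2.trans (Cardinal.lift_le.mpr h4)
  simpa using h5

theorem upper {k A : Type*} [Field k] [CommRing A] [Nontrivial A] [Algebra k A]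
    [Algebra.FiniteType k A] (d : ℕ)
    (H : ∀ P : Ideal A, P.IsPrime → ∀ (s : ℕ) (g : MvPolynomial (Fin s) k →ₐ[k] A ⧸ P),
      Function.Injective g → s ≤ d) : ringKrullDim A ≤ d := by
  obtain ⟨s, g, hg, hi⟩ := exists_integral_inj_algHom_of_fg k A
  refine (dim_le_of_integral _ hi).trans ?_
  let := g.toRingHom.toAlgebra
  have : Algebra.IsIntegral (MvPolynomial (Fin s) k) A := ⟨hi⟩
  obtain ⟨P, -, hP, hc⟩ := Ideal.exists_ideal_over_prime_of_isIntegral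
    (⊥ : Ideal (MvPolynomial (Fin s) k)) (⊥ : Ideal A) (by
      rw [← RingHom.ker_eq_comap_bot]
      exact le_of_eq ((RingHom.injective_iff_ker_eq_bot _).1 hg))
  have hs := H P hP s ((Ideal.Quotient.mkₐ k P).comp g) (by
    rw [injective_iff_map_eq_zero]
    intro a ha
    have : a ∈ P.comap (algebraMap (MvPolynomial (Fin s) k) A) := by
      change g a ∈ P
      simpa [Ideal.Quotient.eq_zero_iff_mem] using ha
    rw [hc] at this
    simpa using this)
  simp [ringKrullDim_eq_zero_of_field]
  exact_mod_cast hs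

theorem lower {k A T : Type*} [Field k] [CommRing A] [CommRing T] [IsDomain T]
    (I : Ideal A) (φ : A →+* Polynomial T) (hI : I ≤ RingHom.ker φ)
    (hs : Function.Surjective ((Polynomial.evalRingHom (0 : T)).comp φ)) (x : A)
    (hx : φ x ≠ 0) (hx0 : (φ x).eval 0 = 0) :
    ringKrullDim T + 1 ≤ ringKrullDim (A ⧸ I) := by
  have h1 : ringKrullDim (A ⧸ RingHom.ker φ) ≤ ringKrullDim (A ⧸ I) :=
    ringKrullDim_le_of_surjective (Ideal.Quotient.factor hI) (Ideal.Quotient.factor_surjective hI)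
  refine le_trans ?_ h1
  have : (RingHom.ker φ).IsPrime := RingHom.ker_isPrime φ
  refine ringKrullDim_succ_le_of_surjective
    (Ideal.Quotient.lift (RingHom.ker φ) ((Polynomial.evalRingHom (0 : T)).comp φ) ?_) ?_
    (r := Ideal.Quotient.mk _ x) ?_ ?_
  · intro a ha
    have : φ a = 0 := ha
    simp [this]
  · exact Ideal.Quotient.lift_surjective_of_surjective _ _ hs
  · rw [mem_nonZeroDivisors_iff_ne_zero, Ne, Ideal.Quotient.eq_zero_iff_mem]
    exact hx
  · simpa using hx0

noncomputable def phi (k : Type*) [Field k] (p q m : ℕ) :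
    MvPolynomial (Fin (m + q + 1) ⊕ Fin (m + p + 1)) k →ₐ[k]
      Polynomial (MvPolynomial (Fin q ⊕ Fin (m + p + 1)) k) :=
  aeval (Sum.elim
    (fun a => if h : (a : ℕ) < m + 1 then
        Polynomial.X * Polynomial.C (X (Sum.inr ⟨p + a, by omega⟩))
      else Polynomial.C (X (Sum.inl ⟨a - (m + 1), by have := a.isLt; omega⟩)))
    (fun b => Polynomial.C (X (Sum.inr b))))

theorem phi_lt (k : Type*) [Field k] (p q m i : ℕ) (h : i < m + 1) (h' : i < m + q + 1) :
    phi k p q m (X (Sum.inl ⟨i, h'⟩)) =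
      Polynomial.X * Polynomial.C (X (Sum.inr ⟨p + i, by omega⟩)) := by
  rw [phi, aeval_X, Sum.elim_inl, dif_pos h]

theorem phi_ge (k : Type*) [Field k] (p q m : ℕ) (a : Fin q) (h' : m + 1 + a < m + q + 1) :
    phi k p q m (X (Sum.inl ⟨m + 1 + a, h'⟩)) = Polynomial.C (X (Sum.inl a)) := by
  rw [phi, aeval_X, Sum.elim_inl, dif_neg (by simp; omega)]
  congr 3
  ext
  simp

theorem phi_inr (k : Type*) [Field k] (p q m : ℕ) (b : Fin (m + p + 1)) :
    phi k p q m (X (Sum.inr b)) = Polynomial.C (X (Sum.inr b)) := by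
  rw [phi, aeval_X, Sum.elim_inr]

theorem phi_surj (k : Type*) [Field k] (p q m : ℕ) : Function.Surjective
    ((Polynomial.evalRingHom (0 : MvPolynomial (Fin q ⊕ Fin (m + p + 1)) k)).comp
      (phi k p q m).toRingHom) := by
  intro t
  induction t using MvPolynomial.induction_on with
  | C a => exact ⟨C a, by simp [phi, MvPolynomial.algebraMap_eq]⟩
  | add p q hp hq =>
    obtain ⟨a, ha⟩ := hp
    obtain ⟨b, hb⟩ := hq
    exact ⟨a + b, by rw [map_add, ha, hb]⟩
  | mul_X r a hp =>
    obtain ⟨c, hc⟩ := hp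
    rcases a with a | b
    · refine ⟨c * X (Sum.inl ⟨m + 1 + a, by omega⟩), ?_⟩
      rw [map_mul, hc]
      congr 1
      change Polynomial.eval 0 (phi k p q m _) = _
      rw [phi_ge, Polynomial.eval_C]
    · refine ⟨c * X (Sum.inr b), ?_⟩
      rw [map_mul, hc]
      congr 1
      change Polynomial.eval 0 (phi k p q m _) = _
      rw [phi_inr, Polynomial.eval_C]

/-- In `R = k[x_p,…,x_{m+p+q}, y_0,…,y_{m+p}]` (the x-variable `x_{p+a}` being indexed by
`a : Fin (m+q+1)` and the y-variable `y_b` by `b : Fin (m+p+1)`), with `I` the ideal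
generated by the binomials `x_i y_j - x_j y_i` for `p ≤ i, j ≤ m + p`, the Krull
dimension of `R/I` is `m + p + q + 2`. -/
theorem determinantal_quotient_krullDim (k : Type*) [Field k] (p q m : ℕ)
    (I : Ideal (MvPolynomial (Fin (m + q + 1) ⊕ Fin (m + p + 1)) k))
    (hI : I = Ideal.span {f | ∃ i j : Fin (m + 1),
      f = X (Sum.inl ⟨(i : ℕ), by have := i.isLt; omega⟩)
            * X (Sum.inr ⟨p + (j : ℕ), by have := j.isLt; omega⟩)
          - X (Sum.inl ⟨(j : ℕ), by have := j.isLt; omega⟩)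
            * X (Sum.inr ⟨p + (i : ℕ), by have := i.isLt; omega⟩)}) :
    ringKrullDim (MvPolynomial (Fin (m + q + 1) ⊕ Fin (m + p + 1)) k ⧸ I)
      = ((m + p + q + 2 : ℕ) : WithBot (WithTop ℕ)) := by
  
  apply le_antisymm
  · have hle : I ≤ RingHom.ker (constantCoeff (σ := Fin (m + q + 1) ⊕ Fin (m + p + 1)) (R := k)) := by
      rw [hI, Ideal.span_le]
      rintro f ⟨i, j, rfl⟩
      simp [RingHom.mem_ker]
    have : Nontrivial (MvPolynomial (Fin (m + q + 1) ⊕ Fin (m + p + 1)) k ⧸ I) := by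
      refine Ideal.Quotient.nontrivial_iff.mpr fun h => ?_
      have : (1 : MvPolynomial (Fin (m + q + 1) ⊕ Fin (m + p + 1)) k) ∈ I := by rw [h]; trivial
      have := hle this
      simp [RingHom.mem_ker] at this
    refine upper (k := k) (m + p + q + 2) ?_
    intro P hP s g hg
    let f := (Ideal.Quotient.mkₐ k P).comp (Ideal.Quotient.mkₐ k I)
    have hf : Function.Surjective f :=
      (Ideal.Quotient.mkₐ_surjective k P).comp (Ideal.Quotient.mkₐ_surjective k I)
    have hrel : ∀ i j : Fin (m + 1), f (X (Sum.inl ⟨(i : ℕ), by have := i.isLt; omega⟩))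
            * f (X (Sum.inr ⟨p + (j : ℕ), by have := j.isLt; omega⟩))
          = f (X (Sum.inl ⟨(j : ℕ), by have := j.isLt; omega⟩))
            * f (X (Sum.inr ⟨p + (i : ℕ), by have := i.isLt; omega⟩)) := by
      intro i j
      rw [← sub_eq_zero, ← map_mul, ← map_mul, ← map_sub]
      have hm : ∀ r ∈ I, f r = 0 := fun r hr => by
        simp [f, Ideal.Quotient.eq_zero_iff_mem.mpr hr]
      apply hm
      rw [hI]
      exact Ideal.subset_span ⟨i, j, rfl⟩
    by_cases hc : ∀ i : Fin (m + 1), f (X (Sum.inl ⟨(i : ℕ), by have := i.isLt; omega⟩)) = 0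
    · have := trdeg_aux f hf (τ := Fin q ⊕ Fin (m + p + 1)) (Sum.elim
        (fun a => f (X (Sum.inl ⟨m + 1 + a, by omega⟩))) (fun b => f (X (Sum.inr b)))) (by
        rintro (a | b)
        · by_cases h : (a : ℕ) < m + 1
          · exact ⟨1, 0, one_mem _, one_ne_zero, zero_mem _, by rw [one_mul]; exact hc ⟨a, h⟩⟩
          · refine ⟨1, _, one_mem _, one_ne_zero, Algebra.subset_adjoin
              ⟨Sum.inl ⟨a - (m + 1), by have := a.isLt; omega⟩, rfl⟩, ?_⟩
            rw [one_mul]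
            simp only [Sum.elim_inl]
            congr 3
            ext
            simp
            omega
        · exact ⟨1, _, one_mem _, one_ne_zero, Algebra.subset_adjoin ⟨Sum.inr b, rfl⟩,
            by simp⟩) s g hg
      simp at this
      omega
    · push Not at hc
      obtain ⟨i, hi⟩ := hc
      have := trdeg_aux f hf (τ := Fin (m + q + 1) ⊕ Option (Fin p)) (Sum.elim
        (fun a => f (X (Sum.inl a))) (fun b => b.elim
          (f (X (Sum.inr ⟨p + i, by have := i.isLt; omega⟩)))
          (fun b => f (X (Sum.inr ⟨b, by omega⟩))))) (by
        rintro (a | b)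
        · exact ⟨1, _, one_mem _, one_ne_zero, Algebra.subset_adjoin ⟨Sum.inl a, rfl⟩,
            by simp⟩
        · by_cases h : (b : ℕ) < p
          · exact ⟨1, _, one_mem _, one_ne_zero,
              Algebra.subset_adjoin ⟨Sum.inr (some ⟨b, h⟩), rfl⟩, by simp⟩
          · have hr := hrel i ⟨b - p, by have := b.isLt; omega⟩
            have hb : (⟨p + (b - p), by have := b.isLt; omega⟩ : Fin (m + p + 1)) = b := by
              ext; simp; omega
            simp only [hb] at hr
            refine ⟨_, _, Algebra.subset_adjoin ⟨Sum.inl ⟨i, by have := i.isLt; omega⟩, rfl⟩, hi,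
              mul_mem (Algebra.subset_adjoin ⟨Sum.inl ⟨b - p, by have := b.isLt; omega⟩, rfl⟩)
              (Algebra.subset_adjoin ⟨Sum.inr none, rfl⟩), ?_⟩
            exact hr) s g hg
      simp at this
      omega
  · have hd : ringKrullDim (MvPolynomial (Fin q ⊕ Fin (m + p + 1)) k) + 1
        = ((m + p + q + 2 : ℕ) : WithBot (WithTop ℕ)) := by
      rw [MvPolynomial.ringKrullDim_of_isNoetherianRing, ringKrullDim_eq_zero_of_field]
      simp only [Nat.card_eq_fintype_card, Fintype.card_sum, Fintype.card_fin, zero_add]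
      norm_cast
      congr 1
      omega
    rw [← hd]
    refine lower (k := k) I (phi k p q m).toRingHom ?_ ?_ (X (Sum.inl ⟨0, by omega⟩)) ?_ ?_
    · rw [hI, Ideal.span_le]
      rintro f ⟨i, j, rfl⟩
      change phi k p q m _ = 0
      rw [map_sub, map_mul, map_mul, phi_lt k p q m i i.isLt, phi_lt k p q m j j.isLt,
        phi_inr, phi_inr]
      ring
    · exact phi_surj k p q m
    · change phi k p q m _ ≠ 0
      rw [phi_lt k p q m 0 (by omega)]
      exact mul_ne_zero Polynomial.X_ne_zero (Polynomial.C_ne_zero.mpr (X_ne_zero _))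
    · change Polynomial.eval 0 (phi k p q m _) = 0
      rw [phi_lt k p q m 0 (by omega)]
      simp
end
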